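/- arXiv:2401.09116 — 2 statements merged into one kernel-verified Lean document; each statement's English description precedes it below -/
import Mathlib

section
/- Let (h, [·,·], *) be a right Post-Lie algebra over a field K of characteristic zero. Then the product * extends uniquely to a bilinear map * : U(h) × U(h) → U(h) on the universal enveloping algebra U(h) such that for all f, g, h ∈ U(h) and y ∈ h (identified with its image in U(h)): (i) ε(f*g) = ε(f)ε(g); (ii) Δ(f*g) = Δ(f)*Δ(g), where * acts componentwise on tensors; (iii) f*1 = f; (iv) 1*f = ε(f)·1; (v) f*(g·y) = (f*g)*y − f*(g*y); (vi) (f·g)*h = (f*h⁽¹⁾)·(g*h⁽²⁾); (vii) (f*g)*h = f*((g*h⁽¹⁾)·h⁽²⁾), where Δ is the usual coproduct of U(h) and Δ(h) = h⁽¹⁾ ⊗ h⁽²⁾ in Sweedler notation. -/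
open TensorProduct

/-- `(L, ⁅·,·⁆, m)` is a right Post-Lie algebra. -/
def IsRightPostLie (K : Type*) {L : Type*} [Field K] [LieRing L] [LieAlgebra K L]
    (m : L →ₗ[K] L →ₗ[K] L) : Prop :=
  (∀ x y z : L, m x ⁅y, z⁆
      = (m (m x y) z - m x (m y z)) - (m (m x z) y - m x (m z y)))
  ∧ (∀ x y z : L, m ⁅x, y⁆ z = ⁅m x z, y⁆ + ⁅x, m y z⁆)

namespace PostLieAux

section generic
variable {K L A : Type*} [Field K] [AddCommGroup L] [Module K L] [Ring A] [Algebra K A]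

lemma gen_ind (i : L →ₗ[K] A) (hgen : Algebra.adjoin K (Set.range i) = ⊤)
    (D : L → A →ₗ[K] A) (m : L →ₗ[K] L →ₗ[K] L)
    (hD : ∀ y a b, D y (a * b) = D y a * b + a * D y b)
    (hDi : ∀ x y, D y (i x) = i (m x y)) :
    ∃ W : ℕ → Submodule K A, W 0 = 1 ∧ (∀ n y a, a ∈ W n → D y a ∈ W n) ∧
      (∀ a, ∃ n, a ∈ W n) ∧ (∀ n, W n ≤ W (n+1)) ∧
      (∀ n (Q : Submodule K A), W n ≤ Q → (∀ a ∈ W n, ∀ y, a * i y ∈ Q) → W (n+1) ≤ Q) := by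
  have hD1 : ∀ y, D y 1 = 0 := fun y => by
    have := hD y 1 1
    simpa using this
  set V : Submodule K A := 1 ⊔ LinearMap.range i with hV
  have h1V : (1 : Submodule K A) ≤ V := le_sup_left
  have hone : (1 : A) ∈ V := h1V (Submodule.one_le.1 le_rfl)
  have hiV : ∀ x, i x ∈ V := fun x => (le_sup_right : LinearMap.range i ≤ V) ⟨x, rfl⟩
  have hVD : ∀ y a, a ∈ V → D y a ∈ V := by
    intro y a ha
    obtain ⟨b, hb, c, ⟨x, rfl⟩, rfl⟩ := Submodule.mem_sup.1 ha
    obtain ⟨k, rfl⟩ := Submodule.mem_one.1 hb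
    rw [map_add, hDi, Algebra.algebraMap_eq_smul_one, map_smul, hD1]
    simpa using hiV _
  have hmono : ∀ n, V ^ n ≤ V ^ (n+1) := by
    intro n a ha
    rw [pow_succ]
    simpa using Submodule.mul_mem_mul ha hone
  have hmono' : Monotone (fun n => V ^ n) := monotone_nat_of_le_succ hmono
  refine ⟨fun n => V ^ n, pow_zero V, ?_, ?_, hmono, ?_⟩
  · intro n
    induction n with
    | zero =>
      intro y a ha
      simp only [pow_zero] at ha ⊢
      obtain ⟨k, rfl⟩ := Submodule.mem_one.1 ha
      rw [Algebra.algebraMap_eq_smul_one, map_smul, hD1]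
      simp
    | succ n ih =>
      intro y a ha
      simp only [pow_succ] at ha ⊢
      induction ha using Submodule.mul_induction_on' with
      | mem_mul_mem s hs t ht =>
        rw [hD]
        exact add_mem (Submodule.mul_mem_mul (ih y s hs) ht) (Submodule.mul_mem_mul hs (hVD y t ht))
      | add s _ t _ h1 h2 => rw [map_add]; exact add_mem h1 h2
  · intro a
    have ha : a ∈ Algebra.adjoin K (Set.range i) := by rw [hgen]; trivial
    induction ha using Algebra.adjoin_induction with
    | mem x hx =>
      obtain ⟨x, rfl⟩ := hx
      exact ⟨1, by simpa using hiV x⟩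
    | algebraMap r => exact ⟨0, by simp [Submodule.mem_one]⟩
    | add x y _ _ hx hy =>
      obtain ⟨p, hp⟩ := hx
      obtain ⟨q, hq⟩ := hy
      exact ⟨p + q, add_mem (hmono' (by simp) hp) (hmono' (by simp) hq)⟩
    | mul x y _ _ hx hy =>
      obtain ⟨p, hp⟩ := hx
      obtain ⟨q, hq⟩ := hy
      exact ⟨p + q, by simp only [pow_add]; exact Submodule.mul_mem_mul hp hq⟩
  · intro n Q h1 h2
    simp only [pow_succ]
    rw [Submodule.mul_le]
    intro s hs t ht
    obtain ⟨b, hb, c, ⟨x, rfl⟩, rfl⟩ := Submodule.mem_sup.1 ht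
    obtain ⟨k, rfl⟩ := Submodule.mem_one.1 hb
    rw [mul_add]
    refine add_mem ?_ (h2 s hs x)
    rw [← Algebra.commutes, ← Algebra.smul_def]
    exact Q.smul_mem _ (h1 hs)

/-- induction along `M_y a = a y + D_y a`. -/
lemma star_ind (i : L →ₗ[K] A) (hgen : Algebra.adjoin K (Set.range i) = ⊤)
    (D : L → A →ₗ[K] A) (m : L →ₗ[K] L →ₗ[K] L)
    (hD : ∀ y a b, D y (a * b) = D y a * b + a * D y b)
    (hDi : ∀ x y, D y (i x) = i (m x y))
    (Q : Submodule K A) (h1 : 1 ∈ Q) (hM : ∀ a ∈ Q, ∀ y, a * i y + D y a ∈ Q) (a : A) :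
    a ∈ Q := by
  obtain ⟨W, h0, hWD, hW, -, hind⟩ := gen_ind i hgen D m hD hDi
  have : ∀ n, W n ≤ Q := by
    intro n
    induction n with
    | zero =>
      rw [h0]
      exact Submodule.one_le.2 h1
    | succ n ih =>
      refine hind n Q ih ?_
      intro b hb y
      have h2 := hM b (ih hb) y
      have h3 := ih (hWD n y b hb)
      simpa using sub_mem h2 h3
  obtain ⟨n, hn⟩ := hW a
  exact this n hn

/-- Leibniz maps (relative to an algebra morphism) are determined on generators. -/
lemma der_ext {C : Type*} [Ring C] [Algebra K C] (φ : A →ₐ[K] C)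
    (i : L →ₗ[K] A) (hgen : Algebra.adjoin K (Set.range i) = ⊤)
    (d e : A →ₗ[K] C) (hd : ∀ a b, d (a * b) = d a * φ b + φ a * d b)
    (he : ∀ a b, e (a * b) = e a * φ b + φ a * e b)
    (h : ∀ x, d (i x) = e (i x)) : d = e := by
  have hd1 : d 1 = 0 := by simpa using hd 1 1
  have he1 : e 1 = 0 := by simpa using he 1 1
  ext a
  have ha : a ∈ Algebra.adjoin K (Set.range i) := by rw [hgen]; trivial
  induction ha using Algebra.adjoin_induction with
  | mem x hx => obtain ⟨x, rfl⟩ := hx; exact h x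
  | algebraMap r => simp [Algebra.algebraMap_eq_smul_one, hd1, he1]
  | add x y _ _ hx hy => simp [hx, hy]
  | mul x y _ _ hx hy => rw [hd, he, hx, hy]

/-- Derivations from algebra morphisms to dual numbers. -/
lemma der_exists (i : L →ₗ[K] A) (hgen : Algebra.adjoin K (Set.range i) = ⊤)
    (m : L →ₗ[K] L →ₗ[K] L)
    (H : ∀ y, ∃ φ : A →ₐ[K] DualNumber A, ∀ x,
      (φ (i x)).fst = i x ∧ (φ (i x)).snd = i (m x y)) :
    ∃ D : L →ₗ[K] A →ₗ[K] A, (∀ y a b, D y (a * b) = D y a * b + a * D y b) ∧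
      (∀ x y, D y (i x) = i (m x y)) := by
  have H' : ∀ y, ∃ d : A →ₗ[K] A, (∀ a b, d (a * b) = d a * b + a * d b) ∧
      ∀ x, d (i x) = i (m x y) := by
    intro y
    obtain ⟨φ, hφ⟩ := H y
    have hf : ∀ a, (φ a).fst = a := by
      intro a
      have ha : a ∈ Algebra.adjoin K (Set.range i) := by rw [hgen]; trivial
      induction ha using Algebra.adjoin_induction with
      | mem x hx => obtain ⟨x, rfl⟩ := hx; exact (hφ x).1
      | algebraMap r => rw [AlgHom.commutes]; rfl
      | add x y _ _ hx hy => simp [hx, hy]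
      | mul x y _ _ hx hy => simp [hx, hy]
    refine ⟨(TrivSqZeroExt.sndHom A A).restrictScalars K ∘ₗ φ.toLinearMap, ?_, fun x => (hφ x).2⟩
    intro a b
    simp [hf, add_comm]
  choose d hd hdi using H'
  refine ⟨LinearMap.mk₂' K K (fun y a => d y a) ?_ ?_ ?_ ?_, ?_, ?_⟩
  · intro y z a
    have : d (y + z) = d y + d z := by
      refine der_ext (AlgHom.id K A) i hgen _ _ (hd _) ?_ ?_
      · intro a b; simp [hd, mul_add, add_mul]; abel
      · intro x; simp [hdi]
    rw [this]; rfl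
  · intro c y a
    have : d (c • y) = c • d y := by
      refine der_ext (AlgHom.id K A) i hgen _ _ (hd _) ?_ ?_
      · intro a b; simp [hd]
      · intro x; simp [hdi]
    rw [this]; rfl
  · intro y a b; simp
  · intro c y a; simp
  · intro y a b; simpa using hd y a b
  · intro x y; simpa using hdi y x

end generic

section tensor
variable {K L : Type*} [Field K] [AddCommGroup L] [Module K L]

lemma tensor_gen : Algebra.adjoin K (Set.range (TensorAlgebra.ι K : L →ₗ[K] TensorAlgebra K L)) = ⊤ :=
  TensorAlgebra.adjoin_range_ι

lemma tensor_der (m : L →ₗ[K] L →ₗ[K] L) :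
    ∃ D : L →ₗ[K] TensorAlgebra K L →ₗ[K] TensorAlgebra K L,
      (∀ y a b, D y (a * b) = D y a * b + a * D y b) ∧
      (∀ x y, D y (TensorAlgebra.ι K x) = TensorAlgebra.ι K (m x y)) := by
  refine der_exists (TensorAlgebra.ι K) tensor_gen m ?_
  intro y
  refine ⟨TensorAlgebra.lift K
    ((TrivSqZeroExt.inlAlgHom K (TensorAlgebra K L) (TensorAlgebra K L)).toLinearMap ∘ₗ
        TensorAlgebra.ι K +
      (TrivSqZeroExt.inrHom (TensorAlgebra K L) (TensorAlgebra K L)).restrictScalars K ∘ₗ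
        TensorAlgebra.ι K ∘ₗ m.flip y), ?_⟩
  intro x
  simp

/-- right recursor for the tensor algebra -/
lemma tensor_rec {E : Type*} [AddCommGroup E] [Module K E] (e : E)
    (c : L →ₗ[K] TensorAlgebra K L →ₗ[K] E) :
    ∃ F : TensorAlgebra K L →ₗ[K] E, F 1 = e ∧
      ∀ t y, F (t * TensorAlgebra.ι K y) = c y t := by
  let T := TensorAlgebra K L
  let o : L →ₗ[K] Module.End K (T × E) := LinearMap.mk₂' K K
    (fun y p => (p.1 * TensorAlgebra.ι K y, c y p.1))
    (by intro y z p; simp [mul_add]) (by intro k y p; simp)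
    (by intro y p q; simp [add_mul]) (by intro k y p; simp)
  let φ : T →ₐ[K] (Module.End K (T × E))ᵐᵒᵖ :=
    TensorAlgebra.lift K ((MulOpposite.opLinearEquiv K).toLinearMap ∘ₗ o)
  have hφι : ∀ y, φ (TensorAlgebra.ι K y) = MulOpposite.op (o y) := fun y =>
    TensorAlgebra.lift_ι_apply _ _
  have hφ : ∀ t y p, (φ (t * TensorAlgebra.ι K y)).unop p = o y ((φ t).unop p) := by
    intro t y p
    rw [map_mul, hφι]
    simp
  have hφ1 : ∀ t s p, ((φ t).unop (s, p)).1 = s * t := by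
    intro t
    have ht : t ∈ Algebra.adjoin K (Set.range (TensorAlgebra.ι K : L →ₗ[K] T)) := by
      rw [tensor_gen]; trivial
    induction ht using Algebra.adjoin_induction with
    | mem x hx =>
      obtain ⟨x, rfl⟩ := hx
      intro s p
      rw [hφι]
      simp [o]
    | algebraMap r =>
      intro s p
      rw [AlgHom.commutes]
      simp [Algebra.algebraMap_eq_smul_one]
    | add x y _ _ hx hy => intro s p; simp [hx, hy, mul_add]
    | mul x y _ _ hx hy =>
      intro s p
      rw [map_mul, MulOpposite.unop_mul, Module.End.mul_apply]
      obtain ⟨q, hq⟩ : ∃ q, (φ x).unop (s, p) = (s * x, q) := ⟨_, Prod.ext (hx s p) rfl⟩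
      rw [hq, hy, mul_assoc]
  refine ⟨LinearMap.snd K T E ∘ₗ (LinearMap.applyₗ ((1 : T), e)) ∘ₗ
    (MulOpposite.opLinearEquiv K).symm.toLinearMap ∘ₗ φ.toLinearMap, ?_, ?_⟩
  · simp
  · intro t y
    have := hφ t y (1, e)
    simp only [LinearMap.comp_apply, LinearMap.snd_apply, LinearMap.applyₗ_apply_apply,
      LinearEquiv.coe_coe, AlgHom.toLinearMap_apply, MulOpposite.coe_opLinearEquiv_symm]
    rw [this]
    simp [o, hφ1]

lemma tensor_R {E : Type*} [AddCommGroup E] [Module K E] (e : E)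
    (m : L →ₗ[K] L →ₗ[K] L)
    (D : L →ₗ[K] TensorAlgebra K L →ₗ[K] TensorAlgebra K L)
    (hD : ∀ y a b, D y (a * b) = D y a * b + a * D y b)
    (hDi : ∀ x y, D y (TensorAlgebra.ι K x) = TensorAlgebra.ι K (m x y))
    (d : L →ₗ[K] E →ₗ[K] E) :
    ∃ R : TensorAlgebra K L →ₗ[K] E, R 1 = e ∧
      ∀ t y, R (t * TensorAlgebra.ι K y + D y t) = d y (R t) := by
  let T := TensorAlgebra K L
  have step : ∀ F : T →ₗ[K] E, ∃ G : T →ₗ[K] E, G 1 = e ∧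
      ∀ t y, G (t * TensorAlgebra.ι K y) = d y (F t) - F (D y t) := by
    intro F
    obtain ⟨G, h1, h2⟩ := tensor_rec e
      (LinearMap.mk₂' K K (fun y t => d y (F t) - F (D y t))
        (by intro y z t; simp; abel) (by intro k y t; simp [smul_sub])
        (by intro y s t; simp; abel) (by intro k y t; simp [smul_sub]))
    exact ⟨G, h1, by simpa using h2⟩
  choose nx hx1 hx2 using step
  obtain ⟨S, hS⟩ : ∃ S : ℕ → T →ₗ[K] E, ∀ n, S (n+1) = nx (S n) :=
    ⟨fun n => Nat.rec 0 (fun _ F => nx F) n, fun n => rfl⟩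
  obtain ⟨W, h0, hWD, hW, hWm, hind⟩ := gen_ind (TensorAlgebra.ι K) tensor_gen (fun y => D y) m hD hDi
  have hstab : ∀ n, ∀ k, n < k → ∀ a ∈ W n, S (k+1) a = S k a := by
    intro n
    induction n with
    | zero =>
      intro k hk a ha
      obtain ⟨k, rfl⟩ : ∃ j, k = j + 1 := ⟨k - 1, by omega⟩
      rw [h0] at ha
      obtain ⟨r, rfl⟩ := Submodule.mem_one.1 ha
      rw [Algebra.algebraMap_eq_smul_one, map_smul, map_smul, hS (k+1), hx1, hS, hx1]
    | succ n ih =>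
      intro k hk
      have : W (n+1) ≤ LinearMap.eqLocus (S (k+1)) (S k) := by
        refine hind n _ (fun a ha => ih k (by omega) a ha) ?_
        intro a ha y
        obtain ⟨k, rfl⟩ : ∃ j, k = j + 1 := ⟨k - 1, by omega⟩
        rw [LinearMap.mem_eqLocus, hS (k+1), hx2, hS k, hx2, ← hS k, ih k (by omega) a ha,
          ih k (by omega) _ (hWD n y a ha)]
      exact fun a ha => this ha
  have hstab' : ∀ n a, a ∈ W n → ∀ k, n < k → S k a = S (n+1) a := by
    intro n a ha k hk
    induction k, hk using Nat.le_induction with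
    | base => rfl
    | succ k hk ih => rw [hstab n k hk a ha, ih]
  choose N hN using hW
  have key : ∀ a, ∃ n, ∀ k, n < k → S k a = S (N a + 1) a := fun a => ⟨N a, hstab' _ a (hN a)⟩
  let R0 : T → E := fun a => S (N a + 1) a
  have key : ∀ a, ∃ n, ∀ k, n < k → S k a = R0 a := key
  have hadd : ∀ a b, R0 (a + b) = R0 a + R0 b := by
    intro a b
    obtain ⟨n1, h1⟩ := key a
    obtain ⟨n2, h2⟩ := key b
    obtain ⟨n3, h3⟩ := key (a + b)
    have hk : ∃ k, n1 < k ∧ n2 < k ∧ n3 < k := ⟨n1 + n2 + n3 + 1, by omega, by omega, by omega⟩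
    obtain ⟨k, k1, k2, k3⟩ := hk
    rw [← h1 k k1, ← h2 k k2, ← h3 k k3, map_add]
  have hsm : ∀ (r : K) a, R0 (r • a) = r • R0 a := by
    intro r a
    obtain ⟨n1, h1⟩ := key a
    obtain ⟨n3, h3⟩ := key (r • a)
    have hk : ∃ k, n1 < k ∧ n3 < k := ⟨n1 + n3 + 1, by omega, by omega⟩
    obtain ⟨k, k1, k3⟩ := hk
    rw [← h1 k k1, ← h3 k k3, map_smul]
  refine ⟨{ toFun := R0, map_add' := hadd, map_smul' := hsm }, ?_, ?_⟩
  · change R0 1 = e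
    obtain ⟨n, h⟩ := key 1
    rw [← h (n+1) (by omega), hS, hx1]
  · intro t y
    change R0 (_ + _) = d y (R0 t)
    rw [hadd]
    obtain ⟨n1, h1⟩ := key t
    obtain ⟨n2, h2⟩ := key (t * TensorAlgebra.ι K y)
    obtain ⟨n3, h3⟩ := key (D y t)
    have hk : ∃ k, n1 < k ∧ n2 < k ∧ n3 < k := ⟨n1 + n2 + n3 + 1, by omega, by omega, by omega⟩
    obtain ⟨k, k1, k2, k3⟩ := hk
    rw [← h1 k k1, ← h2 (k+1) (by omega), ← h3 k k3, hS, hx2]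
    abel
end tensor

section univ
attribute [local instance] LieRing.ofAssociativeRing
open UniversalEnvelopingAlgebra

variable {K L : Type*} [Field K] [LieRing L] [LieAlgebra K L]

lemma mk_surj : Function.Surjective (mkAlgHom K L) := RingCon.mkₐ_surjective _

lemma mk_ι (x : L) : mkAlgHom K L (TensorAlgebra.ι K x) = ι K x := rfl

variable (K L) in
/-- The canonical map as a linear map. -/
noncomputable def jj : L →ₗ[K] UniversalEnvelopingAlgebra K L :=
  (mkAlgHom K L).toLinearMap ∘ₗ TensorAlgebra.ι K

lemma jj_apply (x : L) : jj K L x = ι K x := rfl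

lemma univ_gen : Algebra.adjoin K (Set.range (jj K L)) = ⊤ := by
  have h := congrArg (Subalgebra.map (mkAlgHom K L)) (tensor_gen (K := K) (L := L))
  rw [AlgHom.map_adjoin, Algebra.map_top, (AlgHom.range_eq_top _).2 mk_surj, ← Set.range_comp] at h
  exact h

lemma jj_lie (x y : L) : jj K L ⁅x, y⁆ = jj K L x * jj K L y - jj K L y * jj K L x := by
  simp only [jj_apply]
  rw [LieHom.map_lie, LieRing.of_associative_ring_bracket]

lemma univ_der (m : L →ₗ[K] L →ₗ[K] L)
    (hm : ∀ x y z : L, m ⁅x, y⁆ z = ⁅m x z, y⁆ + ⁅x, m y z⁆) :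
    ∃ D : L →ₗ[K] UniversalEnvelopingAlgebra K L →ₗ[K] UniversalEnvelopingAlgebra K L,
      (∀ y a b, D y (a * b) = D y a * b + a * D y b) ∧
      (∀ x y, D y (jj K L x) = jj K L (m x y)) := by
  refine der_exists (jj K L) univ_gen m ?_
  intro y
  let U := UniversalEnvelopingAlgebra K L
  let f : L →ₗ[K] DualNumber U :=
    (TrivSqZeroExt.inlAlgHom K U U).toLinearMap ∘ₗ jj K L +
      (TrivSqZeroExt.inrHom U U).restrictScalars K ∘ₗ jj K L ∘ₗ m.flip y
  have hf1 : ∀ x, (f x).fst = jj K L x := by intro x; simp [f]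
  have hf2 : ∀ x, (f x).snd = jj K L (m x y) := by intro x; simp [f]
  let g : L →ₗ⁅K⁆ DualNumber U :=
    { f with
      map_lie' := by
        intro a b
        change f ⁅a, b⁆ = ⁅f a, f b⁆
        rw [LieRing.of_associative_ring_bracket]
        ext
        · rw [hf1, TrivSqZeroExt.fst_sub, TrivSqZeroExt.fst_mul, TrivSqZeroExt.fst_mul, hf1, hf1,
            jj_lie]
        · rw [hf2, TrivSqZeroExt.snd_sub, TrivSqZeroExt.snd_mul, TrivSqZeroExt.snd_mul, hf1, hf1,
            hf2, hf2, hm, map_add, jj_lie, jj_lie]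
          simp only [smul_eq_mul, MulOpposite.smul_eq_mul_unop, MulOpposite.unop_op]
          abel }
  refine ⟨lift K g, ?_⟩
  intro x
  have : lift K g (jj K L x) = f x := lift_ι_apply K g x
  rw [this]
  exact ⟨hf1 x, hf2 x⟩

lemma descend {E : Type*} [AddCommGroup E] [Module K E] (R : TensorAlgebra K L →ₗ[K] E)
    (h : ∀ s t x y, R (s * (TensorAlgebra.ι K x * TensorAlgebra.ι K y
      - TensorAlgebra.ι K y * TensorAlgebra.ι K x - TensorAlgebra.ι K ⁅x, y⁆) * t) = 0) :
    ∃ R' : UniversalEnvelopingAlgebra K L →ₗ[K] E, ∀ t, R' (mkAlgHom K L t) = R t := by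
  let c : RingCon (TensorAlgebra K L) :=
    { r := fun a b => ∀ s t, R (s * a * t) = R (s * b * t)
      iseqv := ⟨fun a s t => rfl, fun h s t => (h s t).symm, fun h h' s t => (h s t).trans (h' s t)⟩
      mul' := by
        intro a b c d h1 h2 s t
        have e1 := h1 s (c * t)
        have e2 := h2 (s * b) t
        simp only [mul_assoc] at e1 e2 ⊢
        rw [e1, e2]
      add' := by
        intro a b c d h1 h2 s t
        simp only [mul_add, add_mul, map_add]
        rw [h1, h2] }
  have hc : ringCon K L ≤ c := by
    unfold ringCon
    rw [RingCon.ringConGen_le]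
    intro a b hab
    obtain ⟨x, y⟩ := hab
    intro s t
    have := h s t x y
    simp only [mul_sub, sub_mul, map_sub] at this
    simp only [mul_add, add_mul, map_add]
    rw [sub_sub, sub_eq_zero] at this
    rw [this, add_comm]
  have hker : LinearMap.ker (mkAlgHom K L).toLinearMap ≤ LinearMap.ker R := by
    intro a ha
    have h0 : mkAlgHom K L a = mkAlgHom K L 0 := by simpa using ha
    have h1 : ringCon K L a 0 := (RingCon.eq _).1 h0
    have h2 : c a 0 := hc h1
    simpa using h2 1 1
  refine ⟨(LinearMap.ker (mkAlgHom K L).toLinearMap).liftQ R hker ∘ₗ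
    (LinearMap.quotKerEquivOfSurjective (mkAlgHom K L).toLinearMap mk_surj).symm.toLinearMap, ?_⟩
  intro t
  have : (LinearMap.quotKerEquivOfSurjective (mkAlgHom K L).toLinearMap mk_surj).symm
      (mkAlgHom K L t) = Submodule.Quotient.mk t := by
    rw [LinearEquiv.symm_apply_eq]
    rfl
  simp [this]

/-- commutator identity for the derivations -/
lemma der_comm {A : Type*} [Ring A] [Algebra K A] (i : L →ₗ[K] A)
    (hgen : Algebra.adjoin K (Set.range i) = ⊤)
    (m : L →ₗ[K] L →ₗ[K] L) (hm : IsRightPostLie K m)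
    (D : L →ₗ[K] A →ₗ[K] A)
    (hD : ∀ y a b, D y (a * b) = D y a * b + a * D y b)
    (hDi : ∀ x y, D y (i x) = i (m x y)) (y z : L) (a : A) :
    D ⁅y, z⁆ a = D z (D y a) - D (m y z) a - (D y (D z a) - D (m z y) a) := by
  have : D ⁅y, z⁆ = D z ∘ₗ D y - D (m y z) - (D y ∘ₗ D z - D (m z y)) := by
    refine der_ext (AlgHom.id K A) i hgen _ _ (hD _) ?_ ?_
    · intro a b
      simp only [LinearMap.sub_apply, LinearMap.comp_apply, hD, map_add, AlgHom.id_apply,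
        sub_mul, mul_sub]
      abel
    · intro x
      simp only [LinearMap.sub_apply, LinearMap.comp_apply, hDi]
      rw [hm.1]
      simp
  rw [this]
  simp

lemma univ_R (m : L →ₗ[K] L →ₗ[K] L) (hm : IsRightPostLie K m)
    (D : L →ₗ[K] UniversalEnvelopingAlgebra K L →ₗ[K] UniversalEnvelopingAlgebra K L)
    (hD : ∀ y a b, D y (a * b) = D y a * b + a * D y b)
    (hDi : ∀ x y, D y (jj K L x) = jj K L (m x y)) :
    ∃ R : UniversalEnvelopingAlgebra K L →ₗ[K]
        UniversalEnvelopingAlgebra K L →ₗ[K] UniversalEnvelopingAlgebra K L,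
      R 1 = LinearMap.id ∧ ∀ g y, R (g * jj K L y + D y g) = D y ∘ₗ R g := by
  obtain ⟨DT, hT, hTi⟩ := tensor_der m
  let U := UniversalEnvelopingAlgebra K L
  obtain ⟨R, hR1, hR⟩ := tensor_R (LinearMap.id : U →ₗ[K] U) m DT hT hTi
    (LinearMap.llcomp K U U U ∘ₗ D)
  have hR : ∀ t y, R (t * TensorAlgebra.ι K y + DT y t) = D y ∘ₗ R t := hR
  have hR' : ∀ t y, R (t * TensorAlgebra.ι K y) = D y ∘ₗ R t - R (DT y t) := by
    intro t y
    rw [← hR, map_add, add_sub_cancel_right]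
  have hmk : ∀ y t, mkAlgHom K L (DT y t) = D y (mkAlgHom K L t) := by
    intro y t
    have := der_ext (mkAlgHom K L) (TensorAlgebra.ι K) tensor_gen
      ((mkAlgHom K L).toLinearMap ∘ₗ DT y) (D y ∘ₗ (mkAlgHom K L).toLinearMap)
      (by intro a b; simp [hT]) (by intro a b; simp [hD])
      (by
        intro x
        simp only [LinearMap.comp_apply, hTi]
        exact (hDi x y).symm)
    exact LinearMap.congr_fun this t
  obtain ⟨R', hR''⟩ := descend R (by
    intro s t
    revert s
    let Q : Submodule K (TensorAlgebra K L) :=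
      { carrier := {t | ∀ s (x y : L), R (s * (TensorAlgebra.ι K x * TensorAlgebra.ι K y
          - TensorAlgebra.ι K y * TensorAlgebra.ι K x - TensorAlgebra.ι K ⁅x, y⁆) * t) = 0}
        add_mem' := by
          intro a b ha hb s x y
          rw [mul_add, map_add, ha, hb, add_zero]
        zero_mem' := by intro s x y; simp
        smul_mem' := by
          intro k a ha s x y
          rw [mul_smul_comm, map_smul, ha, smul_zero] }
    refine star_ind (TensorAlgebra.ι K) tensor_gen (fun y => DT y) m hT hTi Q ?_ ?_ t
    · intro s x y
      rw [mul_one, mul_sub, mul_sub, ← mul_assoc, ← mul_assoc, map_sub, map_sub]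
      have c1 := der_comm _ tensor_gen m hm DT hT hTi x y s
      ext u
      have c2 := der_comm _ univ_gen m hm D hD hDi x y (R s u)
      simp only [hR', hT, hTi, map_add, c1, c2, map_sub, LinearMap.sub_apply, LinearMap.add_apply,
        LinearMap.comp_apply, LinearMap.zero_apply]
      abel
    · intro a ha z s x y
      have key : ∀ p : TensorAlgebra K L, p = (TensorAlgebra.ι K x * TensorAlgebra.ι K y
          - TensorAlgebra.ι K y * TensorAlgebra.ι K x - TensorAlgebra.ι K ⁅x, y⁆) →
          s * p * (a * TensorAlgebra.ι K z + DT z a) =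
          (s * p * a * TensorAlgebra.ι K z + DT z (s * p * a)) - DT z s * p * a
            - s * DT z p * a := by
        intro p _
        simp only [hT, mul_add, mul_assoc]
        abel
      rw [key _ rfl, map_sub, map_sub, hR, ha, ha, LinearMap.comp_zero, zero_sub, neg_zero,
        zero_sub, neg_eq_zero]
      have hd : DT z (TensorAlgebra.ι K x * TensorAlgebra.ι K y
          - TensorAlgebra.ι K y * TensorAlgebra.ι K x - TensorAlgebra.ι K ⁅x, y⁆) =
          (TensorAlgebra.ι K (m x z) * TensorAlgebra.ι K y
          - TensorAlgebra.ι K y * TensorAlgebra.ι K (m x z) - TensorAlgebra.ι K ⁅m x z, y⁆) +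
          (TensorAlgebra.ι K x * TensorAlgebra.ι K (m y z)
          - TensorAlgebra.ι K (m y z) * TensorAlgebra.ι K x - TensorAlgebra.ι K ⁅x, m y z⁆) := by
        simp only [map_sub, hT, hTi, hm.2, map_add]
        abel
      rw [hd, mul_add, add_mul, map_add, ha, ha, add_zero])
  refine ⟨R', ?_, ?_⟩
  · rw [← hR1, ← hR'', map_one (mkAlgHom K L)]
  · intro g y
    obtain ⟨t, rfl⟩ := mk_surj g
    rw [hR'', ← hR, ← hR'', map_add (mkAlgHom K L), map_mul (mkAlgHom K L), hmk]
    rfl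

end univ

section main
open UniversalEnvelopingAlgebra
variable {K L : Type*} [Field K] [LieRing L] [LieAlgebra K L]

theorem main (m : L →ₗ[K] L →ₗ[K] L) (hm : IsRightPostLie K m)
    (Δ : UniversalEnvelopingAlgebra K L →ₐ[K]
          UniversalEnvelopingAlgebra K L ⊗[K] UniversalEnvelopingAlgebra K L)
    (hΔ : ∀ x : L, Δ (jj K L x) = jj K L x ⊗ₜ[K] 1 + 1 ⊗ₜ[K] jj K L x)
    (ε : UniversalEnvelopingAlgebra K L →ₐ[K] K)
    (hε : ∀ x : L, ε (jj K L x) = 0) :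
    ∃! B : UniversalEnvelopingAlgebra K L →ₗ[K]
            UniversalEnvelopingAlgebra K L →ₗ[K] UniversalEnvelopingAlgebra K L,
      (∀ x y : L, B (jj K L x) (jj K L y) = jj K L (m x y))
      ∧ (∀ f g, ε (B f g) = ε f * ε g)
      ∧ (∀ f g, Δ (B f g) = TensorProduct.map₂ B B (Δ f) (Δ g))
      ∧ (∀ f, B f 1 = f)
      ∧ (∀ f, B 1 f = ε f • (1 : UniversalEnvelopingAlgebra K L))
      ∧ (∀ f g (y : L), B f (g * jj K L y) = B (B f g) (jj K L y) - B f (B g (jj K L y)))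
      ∧ (∀ f g h, B (f * g) h
            = TensorProduct.lift
                ((LinearMap.mul K (UniversalEnvelopingAlgebra K L)).compl₁₂ (B f) (B g))
                (Δ h))
      ∧ (∀ f g h, B (B f g) h
            = B f (TensorProduct.lift
                ((LinearMap.mul K (UniversalEnvelopingAlgebra K L)).compl₁₂
                  (B g) LinearMap.id)
                (Δ h))) := by
  let U := UniversalEnvelopingAlgebra K L
  obtain ⟨D, hD, hDi⟩ := univ_der m hm.2
  obtain ⟨R, hR1, hR⟩ := univ_R m hm D hD hDi
  have ind := star_ind (jj K L) univ_gen (fun y => D y) m hD hDi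
  have hD1 : ∀ y, D y 1 = 0 := fun y => by simpa using hD y 1 1
  have hRy : ∀ y, R (jj K L y) = D y := by
    intro y
    have := hR 1 y
    rw [hD1, add_zero, one_mul, hR1, LinearMap.comp_id] at this
    exact this
  have hRM : ∀ g y f, R (g * jj K L y + D y g) f = D y (R g f) := by
    intro g y f; rw [hR]; rfl
  have hεD : ∀ y f, ε (D y f) = 0 := by
    intro y f
    have := der_ext ε (jj K L) univ_gen (ε.toLinearMap ∘ₗ D y) 0
      (by intro a b; simp [hD]) (by intro a b; simp) (by intro x; simp [hDi, hε])
    exact LinearMap.congr_fun this f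
  -- the action on the tensor square
  let DD : L → U ⊗[K] U →ₗ[K] U ⊗[K] U := fun y =>
    (D y).rTensor U + (D y).lTensor U
  have hDD : ∀ y a b, DD y (a ⊗ₜ b) = D y a ⊗ₜ b + a ⊗ₜ D y b := by
    intro y a b; simp [DD]
  have hDDmul : ∀ y p q, DD y (p * q) = DD y p * q + p * DD y q := by
    intro y p q
    induction p with
    | zero => simp
    | add p p' h h' => simp only [add_mul, map_add, h, h']; abel
    | tmul a b =>
      induction q with
      | zero => simp
      | add p p' h h' => simp only [mul_add, map_add, h, h']; abel
      | tmul c d =>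
        simp only [Algebra.TensorProduct.tmul_mul_tmul, hDD, hD, add_mul, mul_add,
          TensorProduct.add_tmul, TensorProduct.tmul_add]
        abel
  have hΔD : ∀ y f, Δ (D y f) = DD y (Δ f) := by
    intro y f
    have := der_ext Δ (jj K L) univ_gen (Δ.toLinearMap ∘ₗ D y) (DD y ∘ₗ Δ.toLinearMap)
      (by intro a b; simp [hD]) (by intro a b; simp [hDDmul])
      (by intro x; simp [hDi, hΔ, hDD, hD1])
    exact LinearMap.congr_fun this f
  let MM : L → U ⊗[K] U → U ⊗[K] U := fun y p =>
    p * (jj K L y ⊗ₜ[K] 1 + 1 ⊗ₜ[K] jj K L y) + DD y p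
  have hMMadd : ∀ y p q, MM y (p + q) = MM y p + MM y q := by
    intro y p q; simp only [MM, add_mul, map_add]; abel
  have hMM0 : ∀ y, MM y 0 = 0 := by intro y; simp [MM]
  have hMMt : ∀ y a b, MM y (a ⊗ₜ b) =
      (a * jj K L y + D y a) ⊗ₜ b + a ⊗ₜ (b * jj K L y + D y b) := by
    intro y a b
    simp only [MM, hDD, mul_add, Algebra.TensorProduct.tmul_mul_tmul, mul_one,
      TensorProduct.add_tmul, TensorProduct.tmul_add]
    abel
  have hΔM : ∀ y g, Δ (g * jj K L y + D y g) = MM y (Δ g) := by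
    intro y g; rw [map_add, map_mul, hΔ, hΔD]
  have hB : ∀ f g, R.flip f g = R g f := fun f g => rfl
  -- (vi), (vii) on tensors
  have hvi : ∀ f g y p, TensorProduct.lift ((LinearMap.mul K U).compl₁₂ (R.flip f) (R.flip g))
      (MM y p) = D y (TensorProduct.lift ((LinearMap.mul K U).compl₁₂ (R.flip f) (R.flip g)) p) := by
    intro f g y p
    induction p with
    | zero => simp [hMM0]
    | add p q h h' => rw [hMMadd, map_add, h, h', map_add, map_add]
    | tmul a b =>
      rw [hMMt, map_add]
      simp only [TensorProduct.lift.tmul, LinearMap.compl₁₂_apply, LinearMap.mul_apply', hB,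
        hRM, hD]
  have hvii : ∀ g y p, TensorProduct.lift ((LinearMap.mul K U).compl₁₂ (R.flip g) LinearMap.id)
      (MM y p) =
      (TensorProduct.lift ((LinearMap.mul K U).compl₁₂ (R.flip g) LinearMap.id) p) * jj K L y
      + D y (TensorProduct.lift ((LinearMap.mul K U).compl₁₂ (R.flip g) LinearMap.id) p) := by
    intro g y p
    induction p with
    | zero => simp [hMM0]
    | add p q h h' => rw [hMMadd, map_add, h, h', map_add, map_add, add_mul]; abel
    | tmul a b =>
      rw [hMMt, map_add]
      simp only [TensorProduct.lift.tmul, LinearMap.compl₁₂_apply, LinearMap.mul_apply', hB,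
        hRM, hD, LinearMap.id_apply, mul_add, mul_assoc]
      abel
  have hii : ∀ y p q, TensorProduct.map₂ R.flip R.flip p (MM y q) =
      DD y (TensorProduct.map₂ R.flip R.flip p q) := by
    intro y p q
    induction q with
    | zero => simp [hMM0]
    | add q q' h h' => rw [hMMadd, map_add, h, h', map_add, map_add]
    | tmul c d =>
      induction p with
      | zero => simp
      | add p p' h h' => simp only [map_add, LinearMap.add_apply, h, h']
      | tmul a b =>
        rw [hMMt, map_add]
        simp only [TensorProduct.map₂_apply_tmul, TensorProduct.map_tmul, hB, hRM, hDD]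
  refine ⟨R.flip, ⟨?_, ?_, ?_, ?_, ?_, ?_, ?_, ?_⟩, ?_⟩
  · intro x y
    rw [hB, hRy, hDi]
  · intro f g
    refine ind (LinearMap.eqLocus (ε.toLinearMap ∘ₗ R.flip f) (ε f • ε.toLinearMap)) ?_ ?_ g
    · simp [hR1]
    · intro a ha y
      simp only [LinearMap.mem_eqLocus, LinearMap.comp_apply, hB, hRM]
      simp [hεD, hε]
  · intro f g
    refine ind (LinearMap.eqLocus (Δ.toLinearMap ∘ₗ R.flip f)
      (TensorProduct.map₂ R.flip R.flip (Δ f) ∘ₗ Δ.toLinearMap)) ?_ ?_ g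
    · simp only [LinearMap.mem_eqLocus, LinearMap.comp_apply, hB, hR1, AlgHom.toLinearMap_apply,
        map_one, LinearMap.id_apply]
      generalize Δ f = p
      induction p with
      | zero => simp
      | add p q h h' => simp only [map_add, LinearMap.add_apply, ← h, ← h']
      | tmul a b =>
        simp [Algebra.TensorProduct.one_def, hR1]
    · intro a ha y
      simp only [LinearMap.mem_eqLocus, LinearMap.comp_apply, hB, AlgHom.toLinearMap_apply] at ha ⊢
      rw [hRM, hΔD, ha, hΔM, hii]
  · intro f
    rw [hB, hR1]; rfl
  · intro f
    refine ind (LinearMap.eqLocus (R.flip 1) (ε.toLinearMap.smulRight 1)) ?_ ?_ f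
    · simp [hR1]
    · intro a ha y
      simp only [LinearMap.mem_eqLocus, hB, LinearMap.smulRight_apply] at ha ⊢
      rw [hRM, ha, map_smul, hD1]
      simp [hεD, hε]
  · intro f g y
    simp only [hB, hRy]
    rw [← hRM, map_add, LinearMap.add_apply, add_sub_cancel_right]
  · intro f g h
    refine ind (LinearMap.eqLocus (R.flip (f * g)) (TensorProduct.lift
      ((LinearMap.mul K U).compl₁₂ (R.flip f) (R.flip g)) ∘ₗ Δ.toLinearMap)) ?_ ?_ h
    · simp [hR1, Algebra.TensorProduct.one_def]
    · intro a ha y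
      simp only [LinearMap.mem_eqLocus, LinearMap.comp_apply, AlgHom.toLinearMap_apply] at ha ⊢
      rw [hΔM, hvi, ← ha, hB, hRM, hB]
  · intro f g h
    refine ind (LinearMap.eqLocus (R.flip (R.flip f g)) (R.flip f ∘ₗ TensorProduct.lift
      ((LinearMap.mul K U).compl₁₂ (R.flip g) LinearMap.id) ∘ₗ Δ.toLinearMap)) ?_ ?_ h
    · simp [hR1, Algebra.TensorProduct.one_def]
    · intro a ha y
      simp only [LinearMap.mem_eqLocus, LinearMap.comp_apply, AlgHom.toLinearMap_apply] at ha ⊢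
      rw [hΔM, hvii, hB f (_ + _), hRM, ← hB f (TensorProduct.lift _ _), ← ha, hB _ (_ + _), hRM]
      rfl
  · rintro B ⟨b0, -, -, b3, -, b5, b6, -⟩
    have hBy : ∀ y, B.flip (jj K L y) = D y := by
      intro y
      refine der_ext (AlgHom.id K U) (jj K L) univ_gen _ _ ?_ (hD y) ?_
      · intro a b
        simp only [LinearMap.flip_apply, b6, hΔ, map_add, TensorProduct.lift.tmul,
          LinearMap.compl₁₂_apply, LinearMap.mul_apply', b3, AlgHom.id_apply]
      · intro x
        rw [LinearMap.flip_apply, b0, hDi]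
    have hBy' : ∀ f y, B f (jj K L y) = D y f := by
      intro f y; rw [← hBy]; rfl
    ext f g
    refine ind (LinearMap.eqLocus (B f) (R.flip f)) ?_ ?_ g
    · simp [hR1, b3]
    · intro a ha y
      simp only [LinearMap.mem_eqLocus, hB] at ha ⊢
      rw [hRM, map_add, b5, hBy', hBy', ha, sub_add_cancel]

end main

end PostLieAux

/-- The product of a right Post-Lie algebra `(L, ⁅·,·⁆, m)` extends
uniquely to a bilinear map `B` on `U(L)` satisfying properties (i)–(vii), where `Δ` is the
usual coproduct of `U(L)` (the unique algebra morphism with `Δ(x) = x ⊗ 1 + 1 ⊗ x` on `L`)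
and `ε` its counit. -/
theorem statement9 {K L : Type*} [Field K] [CharZero K] [LieRing L] [LieAlgebra K L]
    (m : L →ₗ[K] L →ₗ[K] L) (hm : IsRightPostLie K m)
    (Δ : UniversalEnvelopingAlgebra K L →ₐ[K]
          UniversalEnvelopingAlgebra K L ⊗[K] UniversalEnvelopingAlgebra K L)
    (hΔ : ∀ x : L, Δ (UniversalEnvelopingAlgebra.ι K x)
        = UniversalEnvelopingAlgebra.ι K x ⊗ₜ[K] (1 : UniversalEnvelopingAlgebra K L)
          + (1 : UniversalEnvelopingAlgebra K L) ⊗ₜ[K] UniversalEnvelopingAlgebra.ι K x)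
    (ε : UniversalEnvelopingAlgebra K L →ₐ[K] K)
    (hε : ∀ x : L, ε (UniversalEnvelopingAlgebra.ι K x) = 0) :
    ∃! B : UniversalEnvelopingAlgebra K L →ₗ[K]
            UniversalEnvelopingAlgebra K L →ₗ[K] UniversalEnvelopingAlgebra K L,
      (∀ x y : L, B (UniversalEnvelopingAlgebra.ι K x) (UniversalEnvelopingAlgebra.ι K y)
          = UniversalEnvelopingAlgebra.ι K (m x y))
      ∧ (∀ f g, ε (B f g) = ε f * ε g)
      ∧ (∀ f g, Δ (B f g) = TensorProduct.map₂ B B (Δ f) (Δ g))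
      ∧ (∀ f, B f 1 = f)
      ∧ (∀ f, B 1 f = ε f • (1 : UniversalEnvelopingAlgebra K L))
      ∧ (∀ f g (y : L), B f (g * UniversalEnvelopingAlgebra.ι K y)
            = B (B f g) (UniversalEnvelopingAlgebra.ι K y)
              - B f (B g (UniversalEnvelopingAlgebra.ι K y)))
      ∧ (∀ f g h, B (f * g) h
            = TensorProduct.lift
                ((LinearMap.mul K (UniversalEnvelopingAlgebra K L)).compl₁₂ (B f) (B g))
                (Δ h))
      ∧ (∀ f g h, B (B f g) h
            = B f (TensorProduct.lift
                ((LinearMap.mul K (UniversalEnvelopingAlgebra K L)).compl₁₂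
                  (B g) LinearMap.id)
                (Δ h))) := by
  exact PostLieAux.main m hm Δ hΔ ε hε
end

section
/- Let K be a field of characteristic zero and H a cocommutative bialgebra over K that is connected as a coalgebra. Then H is generated as a K-algebra by its primitive elements, i.e. the subalgebra of H generated by Prim(H) equals H. -/
open TensorProduct


open TensorProduct

universe u v

/-- A bundled `K`-module, used to form iterated tensor powers. -/
structure ModPack (K : Type u) [CommSemiring K] : Type (max u (v + 1)) where
  carrier : Type v
  [acg : AddCommGroup carrier]
  [mod : Module K carrier]

attribute [instance] ModPack.acg ModPack.mod

/-- `tpk K H n` is the `(n+1)`-fold tensor power `H ⊗ (H ⊗ (⋯ ⊗ H))`. -/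
noncomputable def tpk (K : Type u) [CommSemiring K]
    (H : Type v) [AddCommGroup H] [Module K H] : ℕ → ModPack.{u, v} K
  | 0 => ⟨H⟩
  | n + 1 => ⟨H ⊗[K] (tpk K H n).carrier⟩

/-- The reduced coproduct `Δ̃(x) = Δ(x) - 1 ⊗ x - x ⊗ 1 + ε(x) (1 ⊗ 1)`
(the unique linear map with `Δ̃(1) = 0` and `Δ̃(x) = Δ(x) - 1 ⊗ x - x ⊗ 1` on `ker ε`). -/
noncomputable def redComul (K : Type u) [CommSemiring K]
    (H : Type v) [Ring H] [Bialgebra K H] : H →ₗ[K] H ⊗[K] H :=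
  Coalgebra.comul
    - TensorProduct.mk K H H 1
    - (TensorProduct.mk K H H).flip 1
    + (Coalgebra.counit (R := K)).smulRight ((1 : H) ⊗ₜ[K] (1 : H))

/-- Applying `Δ̃` to the first tensor factor: `Δ̃ ⊗ id^{⊗ n}`. -/
noncomputable def frontMap (K : Type u) [CommSemiring K]
    (H : Type v) [Ring H] [Bialgebra K H] :
    (n : ℕ) → (tpk K H n).carrier →ₗ[K] (tpk K H (n + 1)).carrier
  | 0 => redComul K H
  | n + 1 =>
      (TensorProduct.assoc K H H (tpk K H n).carrier).toLinearMap
        ∘ₗ TensorProduct.map (redComul K H) LinearMap.id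

/-- The iterated reduced coproducts: `Δ̃⁽⁰⁾ = ρ` (with `ρ(x) = x - ε(x)1`), `Δ̃⁽¹⁾ = Δ̃`,
and `Δ̃⁽ᵏ⁺¹⁾ = (Δ̃ ⊗ id^{⊗ k}) ∘ Δ̃⁽ᵏ⁾`. -/
noncomputable def redIter (K : Type u) [CommSemiring K]
    (H : Type v) [Ring H] [Bialgebra K H] :
    (n : ℕ) → H →ₗ[K] (tpk K H n).carrier
  | 0 => LinearMap.id - (Coalgebra.counit (R := K)).smulRight (1 : H)
  | 1 => redComul K H
  | n + 2 => frontMap K H (n + 1) ∘ₗ redIter K H (n + 1)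

/-- `x` is a primitive element of the bialgebra `H`: `Δ(x) = x ⊗ 1 + 1 ⊗ x`. -/
def IsPrimitive (K : Type*) {H : Type*} [CommSemiring K] [Ring H] [Bialgebra K H] (x : H) : Prop :=
  Coalgebra.comul (R := K) x = x ⊗ₜ[K] (1 : H) + (1 : H) ⊗ₜ[K] x

open Polynomial in
lemma poly_uniq {K V : Type*} [Field K] [CharZero K] [Ring V] [Algebra K V] (p : V[X])
    (h : ∀ k : ℕ, p.eval (k : V) = 0) : p = 0 := by
  ext j
  rw [coeff_zero, ← Module.forall_dual_apply_eq_zero_iff K]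
  intro φ
  let q : K[X] := ∑ i ∈ Finset.range (p.natDegree + 1), C (φ (p.coeff i)) * X ^ i
  have hq : ∀ k : ℕ, q.eval (k : K) = φ (p.eval (k : V)) := by
    intro k
    simp only [q, eval_finsetSum, eval_mul, eval_C, eval_pow, eval_X]
    rw [eval_eq_sum_range, map_sum]
    refine Finset.sum_congr rfl fun i _ => ?_
    have : p.coeff i * (k : V) ^ i = ((k : K) ^ i) • p.coeff i := by
      rw [Algebra.smul_def, map_pow, map_natCast]
      exact ((Nat.cast_commute k (p.coeff i)).pow_left i).eq.symm
    rw [this, map_smul, smul_eq_mul, mul_comm]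
  have hq0 : q = 0 := by
    refine Polynomial.eq_zero_of_infinite_isRoot q ?_
    refine Set.Infinite.mono ?_ (Set.infinite_range_of_injective (Nat.cast_injective (R := K)))
    rintro _ ⟨k, rfl⟩
    simp [IsRoot, hq, h]
  by_cases hj : j < p.natDegree + 1
  · have := congrArg (fun r => coeff r j) hq0
    simpa [q, finsetSum_coeff, coeff_C_mul, coeff_X_pow, hj] using this
  · rw [coeff_eq_zero_of_natDegree_lt (by omega), map_zero]

/-- evaluation at a natural number, a ring hom -/
noncomputable def evN (V : Type*) [Ring V] (k : ℕ) : Polynomial V →+* V :=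
  Polynomial.eval₂RingHom' (RingHom.id V) (k : V) (fun a => (Nat.cast_commute k a).symm)

lemma evN_apply {V : Type*} [Ring V] (k : ℕ) (p : Polynomial V) :
    evN V k p = p.eval (k : V) := rfl

section conv
open WithConv LinearMap Coalgebra
variable {K : Type*} [Field K] {H : Type*} [Ring H] [Bialgebra K H]

/-- Identity as a convolution element -/
noncomputable def cId (K H : Type*) [Field K] [Ring H] [Bialgebra K H] :
    WithConv (H →ₗ[K] H) := toConv LinearMap.id

/-- `id - ε` -/
noncomputable def cJ (K H : Type*) [Field K] [Ring H] [Bialgebra K H] :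
    WithConv (H →ₗ[K] H) := cId K H - 1

lemma cJ_apply (x : H) : cJ K H x = x - algebraMap K H (counit (R := K) x) := rfl

lemma cJ_one : cJ K H (1 : H) = 0 := by
  rw [cJ_apply]; simp

lemma comp_cJ (g : WithConv (H →ₗ[K] H)) (x : H) :
    g (cJ K H x) = g x - counit (R := K) x • g 1 := by
  rw [cJ_apply, Algebra.algebraMap_eq_smul_one]
  exact (map_sub g.ofConv _ _).trans (by rw [map_smul])

lemma redComul_eq (x : H) :
    redComul K H x = TensorProduct.map (cJ K H).ofConv (cJ K H).ofConv (comul x) := by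
  let r := ℛ K x
  have h1 := sum_counit_tmul_map_eq (R := K) (LinearMap.id : H →ₗ[K] H) x (repr := r)
  have h2 := sum_map_tmul_counit_eq (R := K) (LinearMap.id : H →ₗ[K] H) x (repr := r)
  have e1 : TensorProduct.map (Algebra.linearMap K H ∘ₗ counit) LinearMap.id (comul (R := K) x)
      = (1 : H) ⊗ₜ[K] x := by
    have := congrArg (TensorProduct.map (Algebra.linearMap K H) LinearMap.id)
      (rTensor_counit_comul (R := K) x)
    rw [LinearMap.rTensor, ← LinearMap.comp_apply, ← TensorProduct.map_comp] at this
    simpa using this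
  have e2 : TensorProduct.map LinearMap.id (Algebra.linearMap K H ∘ₗ counit) (comul (R := K) x)
      = x ⊗ₜ[K] (1 : H) := by
    have := congrArg (TensorProduct.map LinearMap.id (Algebra.linearMap K H))
      (lTensor_counit_comul (R := K) x)
    rw [LinearMap.lTensor, ← LinearMap.comp_apply, ← TensorProduct.map_comp] at this
    simpa using this
  have e3 : TensorProduct.map (Algebra.linearMap K H ∘ₗ counit) (Algebra.linearMap K H ∘ₗ counit)
      (comul (R := K) x) = counit (R := K) x • ((1 : H) ⊗ₜ[K] (1 : H)) := by
    have := congrArg (TensorProduct.map LinearMap.id (Algebra.linearMap K H ∘ₗ counit)) e1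
    rw [← LinearMap.comp_apply, ← TensorProduct.map_comp] at this
    simpa [Algebra.algebraMap_eq_smul_one] using this
  have hJ : (cJ K H).ofConv = LinearMap.id - Algebra.linearMap K H ∘ₗ counit := rfl
  have hsub : ∀ (f g : H →ₗ[K] H) (y : H ⊗[K] H), TensorProduct.map (f - g) (f - g) y =
      TensorProduct.map f f y - TensorProduct.map f g y - TensorProduct.map g f y
        + TensorProduct.map g g y := by
    intro f g y
    induction y using TensorProduct.induction_on with
    | zero => simp
    | add u v hu hv => simp only [map_add, hu, hv]; abel
    | tmul u v =>
      simp only [TensorProduct.map_tmul, LinearMap.sub_apply, TensorProduct.sub_tmul,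
        TensorProduct.tmul_sub]
      abel
  rw [hJ, hsub, e1, e2, e3, TensorProduct.map_id, LinearMap.id_apply]
  simp [redComul]
  abel

lemma convMul_redComul (f g : WithConv (H →ₗ[K] H)) (x : H) :
    LinearMap.mul' K H (TensorProduct.map f.ofConv g.ofConv (redComul K H x)) =
      (toConv (f.ofConv ∘ₗ (cJ K H).ofConv) * toConv (g.ofConv ∘ₗ (cJ K H).ofConv)) x := by
  rw [redComul_eq, ← LinearMap.comp_apply (TensorProduct.map _ _), ← TensorProduct.map_comp]
  rfl

lemma cJ_cJ : toConv ((cJ K H).ofConv ∘ₗ (cJ K H).ofConv) = cJ K H := by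
  ext x
  change cJ K H (cJ K H x) = cJ K H x
  rw [comp_cJ, cJ_one]; simp

/-- multiply up all the tensor factors, applying `f` to the first and `J` to the others -/
noncomputable def mulUp (K H : Type*) [Field K] [Ring H] [Bialgebra K H] :
    (n : ℕ) → (H →ₗ[K] H) → ((tpk K H n).carrier →ₗ[K] H)
  | 0, f => f
  | n + 1, f => LinearMap.mul' K H ∘ₗ TensorProduct.map f (mulUp K H n (cJ K H).ofConv)

lemma mulUp_frontMap (n : ℕ) (f : WithConv (H →ₗ[K] H)) :
    mulUp K H (n + 2) f.ofConv ∘ₗ frontMap K H (n + 1) =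
      mulUp K H (n + 1) (toConv (f.ofConv ∘ₗ (cJ K H).ofConv) * cJ K H).ofConv := by
  apply TensorProduct.ext'
  intro a t
  have h := convMul_redComul f (cJ K H) a
  rw [cJ_cJ] at h
  change _ = (toConv (f.ofConv ∘ₗ (cJ K H).ofConv) * cJ K H) a *
    mulUp K H n (cJ K H).ofConv t
  rw [← h]
  change mulUp K H (n + 2) f.ofConv ((TensorProduct.assoc K H H (tpk K H n).carrier)
    (redComul K H a ⊗ₜ[K] t)) = _
  induction redComul K H a using TensorProduct.induction_on with
  | zero =>
    rw [TensorProduct.zero_tmul, map_zero, map_zero, map_zero, zero_mul]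
    exact LinearMap.map_zero (mulUp K H (n + 2) f.ofConv)
  | add u v hu hv =>
    rw [TensorProduct.add_tmul, map_add, map_add, map_add, add_mul, ← hu, ← hv]
    exact LinearMap.map_add (mulUp K H (n + 2) f.ofConv) _ _
  | tmul u v => 
    change f.ofConv u * ((cJ K H).ofConv v * _) = (f.ofConv u * (cJ K H).ofConv v) * _
    rw [mul_assoc]

lemma mulUp_redIter (n : ℕ) (f : WithConv (H →ₗ[K] H)) (x : H) :
    mulUp K H n f.ofConv (redIter K H n x) =
      (toConv (f.ofConv ∘ₗ (cJ K H).ofConv) * cJ K H ^ n) x := by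
  induction n generalizing f with
  | zero => 
    rw [pow_zero, mul_one]
    change f.ofConv (x - counit (R := K) x • 1) = f.ofConv (cJ K H x)
    rw [cJ_apply, Algebra.algebraMap_eq_smul_one]
  | succ n ih =>
    cases n with
    | zero =>
      have h := convMul_redComul f (cJ K H) x
      rw [cJ_cJ] at h
      rw [zero_add, pow_one, ← h]
      rfl
    | succ n =>
      have h := congrArg (fun g => g (redIter K H (n + 1) x)) (mulUp_frontMap n f)
      change mulUp K H (n + 2) f.ofConv (frontMap K H (n + 1) (redIter K H (n + 1) x)) = _
      refine h.trans ?_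
      rw [ih, pow_succ' _ (n + 1), ← mul_assoc]
      suffices hs : toConv ((toConv (f.ofConv ∘ₗ (cJ K H).ofConv) * cJ K H).ofConv ∘ₗ
          (cJ K H).ofConv) = toConv (f.ofConv ∘ₗ (cJ K H).ofConv) * cJ K H by rw [hs]
      ext y
      change (toConv (f.ofConv ∘ₗ (cJ K H).ofConv) * cJ K H) (cJ K H y) = _
      rw [comp_cJ]
      have : (toConv (f.ofConv ∘ₗ (cJ K H).ofConv) * cJ K H) (1 : H) = 0 := by
        rw [convMul_apply, Bialgebra.comul_one, Algebra.TensorProduct.one_def,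
          TensorProduct.map_tmul]
        have := cJ_one (K := K) (H := H)
        change (cJ K H).ofConv 1 = 0 at this
        simp [this]
      rw [this]; simp

lemma redIter_succ_zero (n : ℕ) (x : H) (h : redIter K H n x = 0) :
    redIter K H (n + 1) x = 0 := by
  cases n with
  | zero => 
    change x - counit (R := K) x • 1 = 0 at h
    change redComul K H x = 0
    rw [sub_eq_zero.1 h, map_smul]
    simp [redComul, Algebra.TensorProduct.one_def]
  | succ n =>
    change frontMap K H (n + 1) (redIter K H (n + 1) x) = 0
    rw [h, map_zero]

lemma cJ_pow_zero (x : H) (hconn : ∃ n : ℕ, redIter K H n x = 0) :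
    ∃ N : ℕ, ∀ m ≥ N, (cJ K H ^ m) x = 0 := by
  obtain ⟨n, hn⟩ := hconn
  have h : ∀ m ≥ n, redIter K H m x = 0 := by
    intro m hm
    induction m, hm using Nat.le_induction with
    | base => exact hn
    | succ m _ ih => exact redIter_succ_zero m x ih
  refine ⟨n + 1, fun m hm => ?_⟩
  obtain ⟨m, rfl⟩ : ∃ k, m = k + 1 := ⟨m - 1, by omega⟩
  have h2 := mulUp_redIter m (cJ K H) x
  rw [cJ_cJ, ← pow_succ', h m (by omega), map_zero] at h2
  exact h2.symm

open Polynomial in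
lemma exists_poly [CharZero K] (x : H) (hconn : ∃ n : ℕ, redIter K H n x = 0) :
    ∃ p : H[X], ∀ k : ℕ, evN H k p = (cId K H ^ k) x := by
  obtain ⟨N, hN⟩ := cJ_pow_zero x hconn
  refine ⟨∑ j ∈ Finset.range N, C ((j.factorial : K)⁻¹ • (cJ K H ^ j) x) * descPochhammer H j,
    fun k => ?_⟩
  have h1 : cId K H = cJ K H + 1 := by simp [cJ]
  have h2 : (cId K H ^ k) x = ∑ j ∈ Finset.range (k + 1), k.choose j • (cJ K H ^ j) x := by
    rw [h1, (Commute.one_right (cJ K H)).add_pow]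
    let ev : WithConv (H →ₗ[K] H) →+ H :=
      { toFun := fun f => f x, map_zero' := rfl, map_add' := fun _ _ => rfl }
    change ev _ = _
    rw [map_sum]
    refine Finset.sum_congr rfl fun j _ => ?_
    rw [one_pow, mul_one, ← nsmul_eq_mul', map_nsmul]
    rfl
  rw [h2, map_sum]
  have h3 : ∀ j, evN H k (C ((j.factorial : K)⁻¹ • (cJ K H ^ j) x) * descPochhammer H j) =
      k.choose j • (cJ K H ^ j) x := by
    intro j
    rw [map_mul, evN_apply, evN_apply, eval_C, descPochhammer_eval_eq_descFactorial,
      Nat.descFactorial_eq_factorial_mul_choose, ← nsmul_eq_mul', mul_comm, mul_nsmul',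
      ← Nat.cast_smul_eq_nsmul K j.factorial, smul_smul,
      mul_inv_cancel₀ (by exact_mod_cast j.factorial_ne_zero), one_smul]
  simp only [h3]
  have ha : ∀ n, (∀ j ≥ n, k.choose j • (cJ K H ^ j) x = 0) →
      ∑ j ∈ Finset.range n, k.choose j • (cJ K H ^ j) x =
      ∑ j ∈ Finset.range (N + k + 1 + n), k.choose j • (cJ K H ^ j) x := by
    intro n hn
    refine Finset.sum_subset (by simp) fun j _ hj => hn j (by simpa using hj)
  have hc : ∀ n, (∀ j ≥ n, k.choose j • (cJ K H ^ j) x = 0) → n ≤ N + k + 1 → 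
      ∑ j ∈ Finset.range n, k.choose j • (cJ K H ^ j) x =
      ∑ j ∈ Finset.range (N + k + 1), k.choose j • (cJ K H ^ j) x := by
    intro n hn hl
    refine Finset.sum_subset (by simpa using hl) fun j _ hj => hn j (by simpa using hj)
  rw [hc N (fun j hj => by rw [hN j hj, smul_zero]) (by omega),
    hc (k + 1) (fun j hj => by rw [Nat.choose_eq_zero_of_lt (by omega), zero_smul]) (by omega)]

lemma algHom_pow {A B : Type*} [Ring A] [Algebra K A] [Ring B] [Algebra K B] (h : A →ₐ[K] B)
    (f : WithConv (H →ₗ[K] A)) (k : ℕ) :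
    toConv (h.toLinearMap ∘ₗ (f ^ k).ofConv) = toConv (h.toLinearMap ∘ₗ f.ofConv) ^ k := by
  induction k with
  | zero => ext x; simp [LinearMap.convOne_def]
  | succ k ih =>
    rw [pow_succ, pow_succ, ← ih, algHom_comp_convMul_distrib]

open Algebra.TensorProduct in
lemma comul_pow (hcocomm : ∀ x : H,
      TensorProduct.comm K H H (Coalgebra.comul (R := K) x) = Coalgebra.comul (R := K) x)
    (k : ℕ) (x : H) : comul (R := K) ((cId K H ^ k) x) =
      TensorProduct.map (cId K H ^ k).ofConv (cId K H ^ k).ofConv (comul (R := K) x) := by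
  let i1 : H →ₐ[K] H ⊗[K] H := includeLeft
  let i2 : H →ₐ[K] H ⊗[K] H := includeRight
  have hm : ∀ f g : WithConv (H →ₗ[K] H), ∀ y, (toConv (i1.toLinearMap ∘ₗ f.ofConv) *
      toConv (i2.toLinearMap ∘ₗ g.ofConv)) y =
      TensorProduct.map f.ofConv g.ofConv (comul (R := K) y) := by
    intro f g y
    rw [convMul_apply]
    induction comul (R := K) y using TensorProduct.induction_on with
    | zero => simp
    | add u v hu hv => simp only [map_add, hu, hv]
    | tmul u v => simp [i1, i2]
  have hm' : ∀ f g : WithConv (H →ₗ[K] H), ∀ y, (toConv (i2.toLinearMap ∘ₗ g.ofConv) *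
      toConv (i1.toLinearMap ∘ₗ f.ofConv)) y =
      TensorProduct.map f.ofConv g.ofConv (comul (R := K) y) := by
    intro f g y
    rw [convMul_apply, ← hcocomm]
    conv_rhs => rw [← hcocomm]
    rw [← hcocomm]
    induction comul (R := K) y using TensorProduct.induction_on with
    | zero => simp
    | add u v hu hv => simp only [map_add, hu, hv]
    | tmul u v => simp [i1, i2]
  have h1 : toConv ((Bialgebra.comulAlgHom K H).toLinearMap ∘ₗ (cId K H).ofConv) =
      toConv (i1.toLinearMap ∘ₗ (cId K H).ofConv) * toConv (i2.toLinearMap ∘ₗ (cId K H).ofConv) := by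
    ext y
    refine Eq.trans ?_ (hm _ _ y).symm
    simp [cId]
  have h2 : Commute (toConv (i1.toLinearMap ∘ₗ (cId K H).ofConv))
      (toConv (i2.toLinearMap ∘ₗ (cId K H).ofConv)) := by
    ext y
    exact (hm _ _ y).trans (hm' _ _ y).symm
  have h3 := algHom_pow (Bialgebra.comulAlgHom K H) (cId K H) k
  rw [h1, h2.mul_pow, ← algHom_pow, ← algHom_pow] at h3
  rw [← hm, ← h3]
  rfl

end conv

open WithConv LinearMap Coalgebra Polynomial in
theorem main_aux {K : Type*} [Field K] [CharZero K]
    {H : Type*} [Ring H] [Bialgebra K H]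
    (hcocomm : ∀ x : H,
      TensorProduct.comm K H H (Coalgebra.comul (R := K) x) = Coalgebra.comul (R := K) x)
    (hconn : ∀ x : H, ∃ n : ℕ, redIter K H n x = 0) :
    Algebra.adjoin K {x : H | _root_.IsPrimitive K x} = ⊤ := by
  choose E0 hE0 using fun x : H => exists_poly (K := K) x (hconn x)
  have uniq : ∀ {V : Type _} [Ring V] [Algebra K V] (p q : V[X]),
      (∀ k, evN V k p = evN V k q) → p = q := by
    intro V _ _ p q h
    rw [← sub_eq_zero]
    refine poly_uniq (K := K) _ fun k => ?_
    rw [← evN_apply, map_sub, h, sub_self]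
  have evsmul : ∀ (k : ℕ) (c : K) (p : H[X]), evN H k (c • p) = c • evN H k p := by
    intro k c p
    rw [evN_apply, evN_apply, eval_smul]
  let E : H →ₗ[K] H[X] :=
    { toFun := E0
      map_add' := fun x y => uniq _ _ fun k => by
        rw [map_add, hE0, hE0, hE0]; exact map_add (cId K H ^ k).ofConv x y
      map_smul' := fun c x => uniq _ _ fun k => by
        rw [RingHom.id_apply, evsmul, hE0, hE0]; exact map_smul (cId K H ^ k).ofConv c x }
  have hE : ∀ x k, evN H k (E x) = (cId K H ^ k) x := hE0
  let e : ℕ → H →ₗ[K] H := fun j =>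
    { toFun := fun x => (E x).coeff j
      map_add' := by simp
      map_smul' := by simp }
  have he : ∀ j x, (E x).coeff j = e j x := fun _ _ => rfl
  have e0 : ∀ x, e 0 x = algebraMap K H (counit (R := K) x) := by
    intro x
    have := hE x 0
    rw [evN_apply, Nat.cast_zero, ← coeff_zero_eq_eval_zero, pow_zero] at this
    exact this
  -- `e 1` is primitive
  have hprim : ∀ x, _root_.IsPrimitive K (e 1 x) := by
    intro x
    let r := ℛ K x
    let D : H →+* H ⊗[K] H := (Bialgebra.comulAlgHom K H).toRingHom
    let i1 : H →+* H ⊗[K] H := (Algebra.TensorProduct.includeLeft : H →ₐ[K] H ⊗[K] H).toRingHom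
    let i2 : H →+* H ⊗[K] H := (Algebra.TensorProduct.includeRight : H →ₐ[K] H ⊗[K] H).toRingHom
    have evmap : ∀ (g : H →+* H ⊗[K] H) (k : ℕ) (p : H[X]),
        evN (H ⊗[K] H) k (p.map g) = g (evN H k p) := by
      intro g k p
      rw [evN_apply, evN_apply, ← map_natCast g, eval_map_apply]
    have key : (E x).map D = ∑ i ∈ r.index, (E (r.left i)).map i1 * (E (r.right i)).map i2 := by
      apply uniq
      intro k
      rw [evmap, hE, map_sum]
      refine (comul_pow hcocomm k x).trans ?_
      rw [← r.eq, map_sum]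
      refine Finset.sum_congr rfl fun i _ => ?_
      rw [map_mul, evmap, evmap, hE, hE]
      simp [i1, i2]
    have key1 := congrArg (fun p => coeff p 1) key
    simp only [coeff_map, finsetSum_coeff, coeff_mul, he, Finset.Nat.antidiagonal_succ,
      Finset.Nat.antidiagonal_zero, Finset.sum_cons, Finset.map_singleton,
      Finset.sum_singleton, Finset.sum_add_distrib] at key1
    have s1 := sum_map_tmul_counit_eq (R := K) (e 1) x (repr := r)
    have s2 := sum_counit_tmul_map_eq (R := K) (e 1) x (repr := r)
    have t1 := congrArg (TensorProduct.map LinearMap.id (Algebra.linearMap K H)) s1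
    have t2 := congrArg (TensorProduct.map (Algebra.linearMap K H) LinearMap.id) s2
    simp only [map_sum, TensorProduct.map_tmul, LinearMap.id_apply, Algebra.linearMap_apply,
      map_one] at t1 t2
    change comul (R := K) (e 1 x) = _
    refine Eq.trans key1 ?_
    rw [← t1, ← t2, add_comm (Finset.sum _ _)]
    congr 1
    · refine Finset.sum_congr rfl fun i _ => ?_
      change (e 1 (r.left i) ⊗ₜ[K] (1 : H)) * ((1 : H) ⊗ₜ[K] e 0 (r.right i)) = _
      rw [Algebra.TensorProduct.tmul_mul_tmul, mul_one, one_mul, e0]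
    · refine Finset.sum_congr rfl fun i _ => ?_
      change (e 0 (r.left i) ⊗ₜ[K] (1 : H)) * ((1 : H) ⊗ₜ[K] e 1 (r.right i)) = _
      rw [Algebra.TensorProduct.tmul_mul_tmul, mul_one, one_mul, e0]
  have hdouble : ∀ x j, (2 : K) ^ j • e j x =
      ∑ i ∈ (ℛ K x).index, ∑ ab ∈ Finset.HasAntidiagonal.antidiagonal j,
        e ab.1 ((ℛ K x).left i) * e ab.2 ((ℛ K x).right i) := by
    intro x j
    have key : (E x).comp (C (2 : H) * X) =
        ∑ i ∈ (ℛ K x).index, E ((ℛ K x).left i) * E ((ℛ K x).right i) := by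
      apply uniq
      intro k
      have : evN H k ((E x).comp (C (2 : H) * X)) = evN H (2 * k) (E x) := by
        rw [evN_apply (2 * k), Polynomial.comp, eval₂_eq_sum_range, eval_eq_sum_range, map_sum]
        refine Finset.sum_congr rfl fun i _ => ?_
        rw [map_mul, map_pow, map_mul, evN_apply, evN_apply, evN_apply]
        simp
      rw [this, hE, two_mul, pow_add, (ℛ K x).convMul_apply, map_sum]
      refine Finset.sum_congr rfl fun i _ => ?_
      rw [map_mul, hE, hE]
    have key1 := congrArg (fun p => coeff p j) key
    simp only [finsetSum_coeff, coeff_mul, he, comp_C_mul_X_coeff] at key1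
    rw [← key1, Algebra.smul_def, map_pow, map_ofNat]
    have := ((Nat.cast_commute 2 (e j x)).pow_left j).eq
    simpa using this
  set S := Algebra.adjoin K {x : H | _root_.IsPrimitive K x} with hS
  have hmem : ∀ j x, e j x ∈ S := by
    intro j
    induction j using Nat.strong_induction_on with
    | _ j ih =>
    intro x
    rcases j with _ | _ | j
    · rw [e0]; exact S.algebraMap_mem _
    · exact Algebra.subset_adjoin (hprim x)
    · have h := hdouble x (j + 2)
      let r := ℛ K x
      have h2 : ∀ i, ∑ ab ∈ Finset.HasAntidiagonal.antidiagonal (j + 2), e ab.1 (r.left i) * e ab.2 (r.right i) =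
          e 0 (r.left i) * e (j + 2) (r.right i) + e (j + 2) (r.left i) * e 0 (r.right i)
          + ∑ ab ∈ Finset.HasAntidiagonal.antidiagonal j, e (ab.1 + 1) (r.left i) * e (ab.2 + 1) (r.right i) := by
        intro i
        rw [Finset.Nat.antidiagonal_succ_succ']
        simp
        abel
      have s1 := sum_map_tmul_counit_eq (R := K) (e (j + 2)) x (repr := r)
      have s2 := sum_counit_tmul_map_eq (R := K) (e (j + 2)) x (repr := r)
      have t1 := congrArg (LinearMap.mul' K H ∘ₗ
        TensorProduct.map LinearMap.id (Algebra.linearMap K H)) s1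
      have t2 := congrArg (LinearMap.mul' K H ∘ₗ
        TensorProduct.map (Algebra.linearMap K H) LinearMap.id) s2
      simp only [map_sum, LinearMap.comp_apply, TensorProduct.map_tmul, LinearMap.id_apply,
        Algebra.linearMap_apply, map_one, LinearMap.mul'_apply, mul_one, one_mul] at t1 t2
      rw [Finset.sum_congr rfl fun i _ => h2 i, Finset.sum_add_distrib, Finset.sum_add_distrib]
        at h
      simp only [e0] at h
      rw [t1, t2] at h
      have h4 : ((2 : K) ^ (j + 2) - 2) • e (j + 2) x = ∑ i ∈ r.index,
          ∑ ab ∈ Finset.HasAntidiagonal.antidiagonal j, e (ab.1 + 1) (r.left i) * e (ab.2 + 1) (r.right i) := by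
        rw [sub_smul, two_smul, h]
        abel
      have hne : ((2 : K) ^ (j + 2) - 2) ≠ 0 := by
        have hn : (2 : ℕ) ^ (j + 2) ≠ 2 := by
          have := Nat.one_le_two_pow (n := j)
          rw [pow_add]; omega
        rw [sub_ne_zero]
        exact_mod_cast hn
      have h5 : ((2 : K) ^ (j + 2) - 2) • e (j + 2) x ∈ S := by
        rw [h4]
        refine S.sum_mem fun i _ => S.sum_mem fun ab hab => S.mul_mem (ih _ ?_ _) (ih _ ?_ _)
        all_goals
          have := Finset.HasAntidiagonal.mem_antidiagonal.1 hab
          omega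
      have h6 := S.smul_mem h5 ((2 : K) ^ (j + 2) - 2)⁻¹
      rwa [smul_smul, inv_mul_cancel₀ hne, one_smul] at h6
  rw [eq_top_iff]
  intro x _
  have h := hE x 1
  rw [pow_one, evN_apply, Nat.cast_one, eval_eq_sum_range] at h
  change _ = x at h
  rw [← h]
  refine S.sum_mem fun i _ => ?_
  rw [one_pow, mul_one]
  exact hmem i x

/-- A cocommutative bialgebra over a field of characteristic zero that is
connected as a coalgebra is generated, as an algebra, by its primitive elements. -/
theorem statement15 {K : Type*} [Field K] [CharZero K]
    {H : Type*} [Ring H] [Bialgebra K H]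
    (hcocomm : ∀ x : H,
      TensorProduct.comm K H H (Coalgebra.comul (R := K) x) = Coalgebra.comul (R := K) x)
    (hconn : ∀ x : H, ∃ n : ℕ, redIter K H n x = 0) :
    Algebra.adjoin K {x : H | IsPrimitive K x} = ⊤ := by
  exact main_aux hcocomm hconn
end
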